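/- Let R ⊆ ℕ be a good set which is sublacunary, let α be an irrational real number, and let ν be a Borel probability measure on 𝕋 that is absolutely continuous with respect to μ_{R,α}. Then there exists a good set S ⊆ R with μ_{S,α} = ν. -/

import Mathlib

open MeasureTheory Filter Topology
open scoped BigOperators

noncomputable section

open Classical in
/-- `S(N) = S ∩ {1,…,N}` as a `Finset`. -/
def initSeg (S : Set ℕ) (N : ℕ) : Finset ℕ := (Finset.Icc 1 N).filter (· ∈ S)

/-- The average `(1/#S(N)) ∑_{s ∈ S(N)} f (sα mod 1)`. -/
def empAvg (S : Set ℕ) (α : ℝ) (N : ℕ) (f : UnitAddCircle → ℝ) : ℝ :=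
  ((initSeg S N).card : ℝ)⁻¹ * ∑ s ∈ initSeg S N, f (((s : ℝ) * α : ℝ) : UnitAddCircle)

/-- `μ` is the weak limit of the empirical measures `(1/#S(N)) ∑_{s ∈ S(N)} δ_{sα mod 1}`. -/
def IsLimitMeasure (S : Set ℕ) (α : ℝ) (μ : Measure UnitAddCircle) : Prop :=
  ∀ f : C(UnitAddCircle, ℝ),
    Tendsto (fun N => empAvg S α N (fun x => f x)) atTop (𝓝 (∫ x, f x ∂μ))

/-- A good set: infinite, and for every `α` the empirical measures converge weakly
to some (probability) limit measure `μ_{S,α}`. -/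
def IsGoodSet (S : Set ℕ) : Prop :=
  S.Infinite ∧ ∀ α : ℝ, ∃ μ : Measure UnitAddCircle, IsProbabilityMeasure μ ∧ IsLimitMeasure S α μ

/-- `R` is sublacunary: `log N / #R(N) → 0`. -/
def Sublacunary (R : Set ℕ) : Prop :=
  Tendsto (fun N : ℕ => Real.log N / ((initSeg R N).card : ℝ)) atTop (𝓝 0)

open Classical in
/-- `#{n < N : r_n ∈ S}` where `(r_n)` is the increasing (0-indexed) enumeration of `R`. -/
def relCount (R S : Set ℕ) (N : ℕ) : ℕ :=
  ((Finset.range N).filter (fun n => Nat.nth (· ∈ R) n ∈ S)).card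

/-- Weighted average `(1/∑_{n<N} w n) ∑_{n<N} w n · f (r_n β mod 1)`. -/
def wAvg (R : Set ℕ) (w : ℕ → ℝ) (β : ℝ) (N : ℕ) (f : UnitAddCircle → ℝ) : ℝ :=
  (∑ n ∈ Finset.range N, w n)⁻¹ *
    ∑ n ∈ Finset.range N, w n * f (((Nat.nth (· ∈ R) n : ℝ) * β : ℝ) : UnitAddCircle)

/-- `μ` is the weak limit of the `w`-weighted empirical measures along `R` at `β`. -/
def IsWeightLimit (R : Set ℕ) (w : ℕ → ℝ) (β : ℝ) (μ : Measure UnitAddCircle) : Prop :=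
  ∀ f : C(UnitAddCircle, ℝ),
    Tendsto (fun N => wAvg R w β N (fun x => f x)) atTop (𝓝 (∫ x, f x ∂μ))

/-- A good weight on `R` (indexed by the increasing enumeration of `R`). -/
def IsGoodWeight (R : Set ℕ) (w : ℕ → ℝ) : Prop :=
  (∀ n, 0 ≤ w n) ∧ ¬ Summable w ∧
    ∀ β : ℝ, ∃ μ : Measure UnitAddCircle, IsProbabilityMeasure μ ∧ IsWeightLimit R w β μ

/-- Besicovitch-type seminorm `‖f‖₁ = limsup_N (1/N) ∑_{n<N} |f n|`. -/
def besic (f : ℕ → ℝ) : ℝ := Filter.limsup (fun N => (∑ n ∈ Finset.range N, |f n|) / N) atTop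

/-- An integrable weight: approximable in `‖·‖₁` by bounded good weights. -/
def IntegrableWeight (R : Set ℕ) (w : ℕ → ℝ) : Prop :=
  ∀ ε > 0, ∃ v : ℕ → ℝ, IsGoodWeight R v ∧ (∃ C, ∀ n, v n ≤ C) ∧
    besic (fun n => v n - w n) < ε

/-- Total variation distance between two finite Borel measures on the torus. -/
def varDist (μ ν : Measure UnitAddCircle) : ℝ :=
  ⨆ B : Set UnitAddCircle, ⨆ _ : MeasurableSet B, |(μ B).toReal - (ν B).toReal|

/-- `e(θ) = exp(2πiθ)`. -/
def eC (θ : ℝ) : ℂ := Complex.exp (2 * Real.pi * Complex.I * θ)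

/-- `w(R(N)) = ∑_{r ∈ R(N)} w r`. -/
def wSum (R : Set ℕ) (w : ℕ → ℝ) (N : ℕ) : ℝ := ∑ r ∈ initSeg R N, w r

/-- `μ` is the weak limit of `(1/w(R(N))) ∑_{r ∈ R(N)} w r · δ_{rβ mod 1}`. -/
def IsWeightLimitR (R : Set ℕ) (w : ℕ → ℝ) (β : ℝ) (μ : Measure UnitAddCircle) : Prop :=
  ∀ f : C(UnitAddCircle, ℝ),
    Tendsto
      (fun N => (wSum R w N)⁻¹ * ∑ r ∈ initSeg R N, w r * f (((r : ℝ) * β : ℝ) : UnitAddCircle))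
      atTop (𝓝 (∫ x, f x ∂μ))

/-- `f : ℕ → ℂ` has mean `c`. -/
def HasMean (f : ℕ → ℂ) (c : ℂ) : Prop :=
  Tendsto (fun N => (∑ n ∈ Finset.range N, f n) / (N : ℂ)) atTop (𝓝 c)

/-- The seminorm `‖f‖_M = limsup_N |(1/N) ∑_{n<N} f n|`. -/
def meanSeminorm (f : ℕ → ℂ) : ℝ :=
  Filter.limsup (fun N => ‖(∑ n ∈ Finset.range N, f n) / (N : ℂ)‖) atTop

end

open ProbabilityTheory

lemma norm_eC (x : ℝ) : ‖eC x‖ = 1 := by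
  have : 2 * (Real.pi : ℂ) * Complex.I * (x : ℂ) = ((2 * Real.pi * x : ℝ) : ℂ) * Complex.I := by
    push_cast; ring
  rw [eC, this, Complex.norm_exp_ofReal_mul_I]

lemma eC_add (x y : ℝ) : eC (x + y) = eC x * eC y := by
  simp only [eC, ← Complex.exp_add]
  congr 1; push_cast; ring

lemma eC_zero : eC 0 = 1 := by simp [eC]

lemma eC_intCast (k : ℤ) : eC k = 1 := by
  rw [eC, Complex.exp_eq_one_iff]
  exact ⟨k, by push_cast; ring⟩

lemma fourier_coe_eq_eC (k : ℤ) (x : ℝ) : fourier k (x : UnitAddCircle) = eC (k * x) := by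
  rw [fourier_coe_apply, eC]
  congr 1; push_cast; ring

lemma norm_eC_sub_eC_le (x y : ℝ) : ‖eC x - eC y‖ ≤ 7 * |x - y| := by
  have h : eC x - eC y = eC y * (Complex.exp (Complex.I * ((2 * Real.pi * (x - y) : ℝ) : ℂ)) - 1) := by
    rw [mul_sub, mul_one, show x = y + (x - y) by ring, eC_add]
    congr 2
    rw [eC]; congr 1; push_cast; ring
  rw [h, norm_mul, norm_eC, one_mul]
  refine (Real.norm_exp_I_mul_ofReal_sub_one_le).trans ?_
  rw [Real.norm_eq_abs, abs_mul, abs_of_pos Real.two_pi_pos]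
  gcongr
  linarith [Real.pi_lt_d2]

/-- Convergence of uniformly bounded functionals extends from a total set to the whole space. -/
lemma exists_tendsto_of_total {E : Type*} [NormedAddCommGroup E] [NormedSpace ℂ E] {s : Set E}
    (hs : (Submodule.span ℂ s).topologicalClosure = ⊤) (A : ℕ → E →ₗ[ℂ] ℂ)
    (hA : ∀ N f, ‖A N f‖ ≤ ‖f‖) (h : ∀ g ∈ s, ∃ l, Tendsto (fun N => A N g) atTop (𝓝 l)) (f : E) :
    ∃ l, Tendsto (fun N => A N f) atTop (𝓝 l) := by
  have hspan : ∀ g ∈ Submodule.span ℂ s, ∃ l, Tendsto (fun N => A N g) atTop (𝓝 l) := by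
    intro g hg
    induction hg using Submodule.span_induction with
    | mem x hx => exact h x hx
    | zero => exact ⟨0, by simp⟩
    | add x y _ _ hx hy =>
      obtain ⟨l, hl⟩ := hx
      obtain ⟨m, hm⟩ := hy
      exact ⟨l + m, by simpa using hl.add hm⟩
    | smul a x _ hx =>
      obtain ⟨l, hl⟩ := hx
      exact ⟨a * l, by simpa using hl.const_mul a⟩
  refine cauchySeq_tendsto_of_complete (Metric.cauchySeq_iff'.2 fun ε hε => ?_)
  have hf : f ∈ closure (Submodule.span ℂ s : Set E) := by
    rw [← Submodule.topologicalClosure_coe, hs]; trivial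
  obtain ⟨g, hg, hfg⟩ := Metric.mem_closure_iff.1 hf (ε / 3) (by positivity)
  obtain ⟨l, hl⟩ := hspan g hg
  obtain ⟨N, hN⟩ := Metric.cauchySeq_iff'.1 hl.cauchySeq (ε / 3) (by positivity)
  refine ⟨N, fun n hn => ?_⟩
  have key : ∀ m, dist (A m f) (A m g) < ε / 3 := fun m => by
    rw [dist_eq_norm, ← map_sub]
    exact (hA m _).trans_lt (by rwa [← dist_eq_norm])
  calc dist (A n f) (A N f) ≤ dist (A n f) (A n g) + dist (A n g) (A N g) + dist (A N g) (A N f) :=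
        dist_triangle4 _ _ _ _
    _ < ε / 3 + ε / 3 + ε / 3 := by
        gcongr
        · exact key n
        · exact hN n hn
        · rw [dist_comm]; exact key N
    _ = ε := by ring

/-- The functional `f ↦ (#F)⁻¹ ∑_{r ∈ F} c r * f (x r)`. -/
noncomputable def avgMap (F : Finset ℕ) (x : ℕ → UnitAddCircle) (c : ℕ → ℂ) :
    C(UnitAddCircle, ℂ) →ₗ[ℂ] ℂ where
  toFun f := ((F.card : ℂ))⁻¹ * ∑ r ∈ F, c r * f (x r)
  map_add' f g := by simp [mul_add, Finset.sum_add_distrib]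
  map_smul' a f := by
    simp only [ContinuousMap.coe_smul, Pi.smul_apply, smul_eq_mul, RingHom.id_apply,
      Finset.mul_sum]
    exact Finset.sum_congr rfl fun r _ => by ring

lemma avgMap_apply (F : Finset ℕ) (x : ℕ → UnitAddCircle) (c : ℕ → ℂ) (f : C(UnitAddCircle, ℂ)) :
    avgMap F x c f = ((F.card : ℂ))⁻¹ * ∑ r ∈ F, c r * f (x r) := rfl

lemma norm_card_inv_mul_sum_le (F : Finset ℕ) (a : ℕ → ℂ) {K : ℝ} (hK : 0 ≤ K)
    (ha : ∀ r ∈ F, ‖a r‖ ≤ K) : ‖((F.card : ℂ))⁻¹ * ∑ r ∈ F, a r‖ ≤ K := by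
  rw [norm_mul, norm_inv, Complex.norm_natCast]
  rcases F.card.eq_zero_or_pos with h | h
  · simpa [h] using hK
  · rw [inv_mul_le_iff₀ (by positivity)]
    simpa using norm_sum_le_of_le F ha

lemma norm_avgMap_le (F : Finset ℕ) (x : ℕ → UnitAddCircle) {c : ℕ → ℂ} (hc : ∀ r, ‖c r‖ ≤ 1)
    (f : C(UnitAddCircle, ℂ)) : ‖avgMap F x c f‖ ≤ ‖f‖ := by
  refine norm_card_inv_mul_sum_le F _ (norm_nonneg f) fun r _ => ?_
  rw [norm_mul]
  exact (mul_le_of_le_one_left (norm_nonneg _) (hc r)).trans (f.norm_coe_le_norm _)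

lemma exists_tendsto_avgMap (F : ℕ → Finset ℕ) (x : ℕ → UnitAddCircle) {c : ℕ → ℂ}
    (hc : ∀ r, ‖c r‖ ≤ 1)
    (h : ∀ k : ℤ, ∃ l, Tendsto (fun N => avgMap (F N) x c (fourier k)) atTop (𝓝 l))
    (f : C(UnitAddCircle, ℂ)) : ∃ l, Tendsto (fun N => avgMap (F N) x c f) atTop (𝓝 l) :=
  exists_tendsto_of_total (span_fourier_closure_eq_top (T := 1)) (fun N => avgMap (F N) x c)
    (fun N f => norm_avgMap_le _ _ hc f) (by rintro _ ⟨k, rfl⟩; exact h k) f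

/-- The averages of the character `r ↦ e(rθ)` over `F`. -/
noncomputable def charAvg (F : Finset ℕ) (θ : ℝ) : ℂ := ((F.card : ℂ))⁻¹ * ∑ r ∈ F, eC (r * θ)

/-- A real-valued function viewed as a complex-valued one. -/
def toComplex (f : C(UnitAddCircle, ℝ)) : C(UnitAddCircle, ℂ) :=
  ⟨fun x => (f x : ℂ), by fun_prop⟩

lemma toComplex_apply (f : C(UnitAddCircle, ℝ)) (x : UnitAddCircle) : toComplex f x = f x := rfl

lemma avgMap_one_toComplex (S : Set ℕ) (β : ℝ) (N : ℕ) (f : C(UnitAddCircle, ℝ)) :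
    avgMap (initSeg S N) (fun r => ((r * β : ℝ) : UnitAddCircle)) (fun _ => 1) (toComplex f) =
      (empAvg S β N (fun x => f x) : ℂ) := by
  simp [avgMap_apply, empAvg, toComplex_apply]

lemma avgMap_one_fourier (F : Finset ℕ) (β : ℝ) (k : ℤ) :
    avgMap F (fun r => ((r * β : ℝ) : UnitAddCircle)) (fun _ => 1) (fourier k) =
      charAvg F (k * β) := by
  simp only [avgMap_apply, one_mul, fourier_coe_eq_eC, charAvg]
  congr 1
  exact Finset.sum_congr rfl fun r _ => by congr 1; ring

lemma tendsto_avgMap_of_isLimitMeasure {S : Set ℕ} {β : ℝ} {μ : Measure UnitAddCircle}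
    [IsFiniteMeasure μ] (h : IsLimitMeasure S β μ) (f : C(UnitAddCircle, ℂ)) :
    Tendsto (fun N => avgMap (initSeg S N) (fun r => ((r * β : ℝ) : UnitAddCircle))
      (fun _ => 1) f) atTop (𝓝 (∫ x, f x ∂μ)) := by
  let fr : C(UnitAddCircle, ℝ) := ⟨fun x => (f x).re, by fun_prop⟩
  let fi : C(UnitAddCircle, ℝ) := ⟨fun x => (f x).im, by fun_prop⟩
  have hf : f = toComplex fr + Complex.I • toComplex fi := by
    ext x
    simp only [ContinuousMap.add_apply, ContinuousMap.smul_apply, toComplex_apply, smul_eq_mul]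
    rw [mul_comm]
    exact (Complex.re_add_im (f x)).symm
  have hint : ∀ g : C(UnitAddCircle, ℝ), Integrable (fun x => (g x : ℂ)) μ := fun g =>
    (toComplex g).continuous.integrable_of_hasCompactSupport
      (HasCompactSupport.of_compactSpace _)
  have hval : ∫ x, f x ∂μ = ((∫ x, fr x ∂μ : ℝ) : ℂ) + Complex.I * ((∫ x, fi x ∂μ : ℝ) : ℂ) := by
    rw [← integral_complex_ofReal, ← integral_complex_ofReal, ← integral_const_mul,
      ← integral_add (hint fr) ((hint fi).const_mul _)]
    refine integral_congr_ae (Eventually.of_forall fun x => ?_)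
    conv_lhs => rw [hf]
    simp [toComplex_apply]
  rw [hval]
  have h1 := (Complex.continuous_ofReal.tendsto _).comp (h fr)
  have h2 := ((Complex.continuous_ofReal.tendsto _).comp (h fi)).const_mul Complex.I
  refine (h1.add h2).congr fun N => ?_
  rw [hf, map_add, map_smul, avgMap_one_toComplex, avgMap_one_toComplex]
  simp [fr, fi]

lemma mem_initSeg {S : Set ℕ} {N r : ℕ} : r ∈ initSeg S N ↔ (1 ≤ r ∧ r ≤ N) ∧ r ∈ S := by
  classical
  simp [initSeg]

lemma initSeg_mono (S : Set ℕ) {M N : ℕ} (h : M ≤ N) : initSeg S M ⊆ initSeg S N := fun r hr => by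
  rw [mem_initSeg] at hr ⊢
  exact ⟨⟨hr.1.1, hr.1.2.trans h⟩, hr.2⟩

lemma tendsto_card_initSeg {S : Set ℕ} (hS : S.Infinite) :
    Tendsto (fun N => ((initSeg S N).card : ℝ)) atTop atTop := by
  refine tendsto_natCast_atTop_atTop.comp (tendsto_atTop_atTop_of_monotone
    (fun M N h => Finset.card_le_card (initSeg_mono S h)) fun b => ?_)
  obtain ⟨t, ht, htc⟩ := (hS.sdiff (Set.finite_singleton 0)).exists_subset_card_eq b
  refine ⟨t.sup id, htc.ge.trans (Finset.card_le_card fun r hr => ?_)⟩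
  have := ht hr
  exact mem_initSeg.2 ⟨⟨Nat.one_le_iff_ne_zero.2 this.2, Finset.le_sup (f := id) hr⟩, this.1⟩

lemma eventually_card_initSeg_pos {S : Set ℕ} (hS : S.Infinite) :
    ∀ᶠ N in atTop, (0 : ℝ) < (initSeg S N).card :=
  (tendsto_card_initSeg hS).eventually_gt_atTop 0

lemma IsLimitMeasure.isProbabilityMeasure {S : Set ℕ} (hS : S.Infinite) {β : ℝ}
    {μ : Measure UnitAddCircle} (h : IsLimitMeasure S β μ) : IsProbabilityMeasure μ := by
  have h1 := h 1
  have h2 : Tendsto (fun N => empAvg S β N (fun x => (1 : C(UnitAddCircle, ℝ)) x)) atTop (𝓝 1) := by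
    refine tendsto_const_nhds.congr' ?_
    filter_upwards [eventually_card_initSeg_pos hS] with N hN
    simp [empAvg, inv_mul_cancel₀ hN.ne']
  have h3 := tendsto_nhds_unique h1 h2
  simp only [ContinuousMap.one_apply, integral_const, smul_eq_mul, mul_one] at h3
  refine ⟨?_⟩
  rw [measureReal_def] at h3
  exact (ENNReal.toReal_eq_one_iff _).1 h3

/-- Convergence of all character averages implies goodness. -/
lemma isGoodSet_of_charAvg {S : Set ℕ} (hS : S.Infinite)
    (h : ∀ θ : ℝ, ∃ l, Tendsto (fun N => charAvg (initSeg S N) θ) atTop (𝓝 l)) :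
    IsGoodSet S := by
  refine ⟨hS, fun β => ?_⟩
  have hconv : ∀ f : C(UnitAddCircle, ℝ), ∃ l,
      Tendsto (fun N => empAvg S β N (fun x => f x)) atTop (𝓝 l) := fun f => by
    obtain ⟨l, hl⟩ := exists_tendsto_avgMap (initSeg S) (fun r => ((r * β : ℝ) : UnitAddCircle))
      (c := fun _ => 1) (by simp) (fun k => by
        obtain ⟨l, hl⟩ := h (k * β)
        exact ⟨l, by simpa only [avgMap_one_fourier] using hl⟩) (toComplex f)
    refine ⟨l.re, ?_⟩
    refine ((Complex.continuous_re.tendsto l).comp hl).congr fun N => ?_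
    rw [Function.comp_apply, avgMap_one_toComplex, Complex.ofReal_re]
  let emp : ℕ → Measure UnitAddCircle := fun N =>
    ((initSeg S N).card : ENNReal)⁻¹ •
      ∑ r ∈ initSeg S N, Measure.dirac ((r * β : ℝ) : UnitAddCircle)
  have hprob : ∀ᶠ N in atTop, IsProbabilityMeasure (emp N) := by
    filter_upwards [eventually_card_initSeg_pos hS] with N hN
    refine ⟨?_⟩
    have hN' : (initSeg S N).card ≠ 0 := by exact_mod_cast hN.ne'
    simp [emp, ENNReal.inv_mul_cancel, hN']
  have hint : ∀ N (f : C(UnitAddCircle, ℝ)), ∫ x, f x ∂(emp N) = empAvg S β N (fun x => f x) := by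
    intro N f
    simp only [emp, integral_smul_measure, empAvg]
    rw [integral_finsetSum_measure fun r _ => integrable_dirac (by simp)]
    simp
  classical
  let P : ℕ → ProbabilityMeasure UnitAddCircle := fun N =>
    if hN : IsProbabilityMeasure (emp N) then ⟨emp N, hN⟩ else ⟨Measure.dirac 0, inferInstance⟩
  have hle := ((hyperfilter ℕ).map P).le_nhds_lim
  set Q := ((hyperfilter ℕ).map P).lim with hQ
  have hPQ : Tendsto P (hyperfilter ℕ : Filter ℕ) (𝓝 Q) := hle
  refine ⟨Q, inferInstance, fun f => ?_⟩
  obtain ⟨l, hl⟩ := hconv f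
  have h1 := (ProbabilityMeasure.tendsto_iff_forall_integral_tendsto.1 hPQ)
    (BoundedContinuousFunction.mkOfCompact f)
  have h2 := hl.mono_left Nat.hyperfilter_le_atTop
  have h3 := tendsto_nhds_unique (h2.congr' ?_) h1
  · rw [h3] at hl
    exact hl
  · filter_upwards [Nat.hyperfilter_le_atTop hprob] with N hN
    have hPN : P N = ⟨emp N, hN⟩ := dif_pos hN
    rw [hPN]
    exact (hint N f).symm

/-- Integration against a probability measure, as a continuous functional. -/
noncomputable def integralFunctional (μ : Measure UnitAddCircle) [IsProbabilityMeasure μ] :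
    C(UnitAddCircle, ℂ) →L[ℂ] ℂ :=
  LinearMap.mkContinuous
    { toFun := fun f => ∫ x, f x ∂μ
      map_add' := fun f g => integral_add
        (f.continuous.integrable_of_hasCompactSupport (HasCompactSupport.of_compactSpace _))
        (g.continuous.integrable_of_hasCompactSupport (HasCompactSupport.of_compactSpace _))
      map_smul' := fun a f => integral_const_mul a _ } 1 fun f => by
    simpa using norm_integral_le_of_norm_le_const (μ := μ)
      (Eventually.of_forall fun x => f.norm_coe_le_norm x)

lemma isLimitMeasure_of_charAvg {S : Set ℕ} (hS : IsGoodSet S) {α : ℝ} {ν : Measure UnitAddCircle}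
    [IsProbabilityMeasure ν] (h : ∀ k : ℤ,
      Tendsto (fun N => charAvg (initSeg S N) (k * α)) atTop (𝓝 (∫ x, fourier k x ∂ν))) :
    IsLimitMeasure S α ν := by
  obtain ⟨μ, hμp, hμ⟩ := hS.2 α
  have heq : integralFunctional μ = integralFunctional ν := by
    refine ContinuousLinearMap.ext_on (s := Set.range (fourier (T := 1))) ?_ ?_
    · rw [dense_iff_closure_eq, ← Submodule.topologicalClosure_coe, span_fourier_closure_eq_top]
      rfl
    · rintro _ ⟨k, rfl⟩
      refine tendsto_nhds_unique (tendsto_avgMap_of_isLimitMeasure hμ (fourier k)) ?_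
      exact (h k).congr fun N => (avgMap_one_fourier _ _ _).symm
  intro f
  have h1 : ∫ x, (f x : ℂ) ∂μ = ∫ x, (f x : ℂ) ∂ν := DFunLike.congr_fun heq (toComplex f)
  rw [integral_complex_ofReal, integral_complex_ofReal] at h1
  rw [← Complex.ofReal_injective h1]
  exact hμ f

lemma IsGoodSet.exists_tendsto_charAvg {S : Set ℕ} (hS : IsGoodSet S) (θ : ℝ) :
    ∃ l, Tendsto (fun N => charAvg (initSeg S N) θ) atTop (𝓝 l) := by
  obtain ⟨μ, _, hμ⟩ := hS.2 θ
  refine ⟨_, (tendsto_avgMap_of_isLimitMeasure hμ (fourier 1)).congr fun N => ?_⟩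
  rw [avgMap_one_fourier, Int.cast_one, one_mul]

/-- Averages of `g(rα) e(rβ)` over a good set converge for continuous `g`. -/
lemma IsGoodSet.exists_tendsto_twisted {R : Set ℕ} (hR : IsGoodSet R) (α β : ℝ)
    (g : C(UnitAddCircle, ℂ)) :
    ∃ l, Tendsto (fun N => avgMap (initSeg R N) (fun r => ((r * α : ℝ) : UnitAddCircle))
      (fun r => eC (r * β)) g) atTop (𝓝 l) := by
  refine exists_tendsto_avgMap _ _ (fun r => (norm_eC _).le) (fun k => ?_) g
  obtain ⟨l, hl⟩ := hR.exists_tendsto_charAvg (β + k * α)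
  refine ⟨l, hl.congr fun N => ?_⟩
  rw [avgMap_apply, charAvg]
  congr 1
  refine Finset.sum_congr rfl fun r _ => ?_
  rw [fourier_coe_eq_eC, ← eC_add]
  congr 1; ring

/-- A density is approximated in `L¹` by nonnegative continuous functions, at a geometric rate. -/
lemma exists_continuous_approx_rnDeriv {μ ν : Measure UnitAddCircle} [IsProbabilityMeasure μ]
    [IsProbabilityMeasure ν] (hac : ν ≪ μ) :
    ∃ g : ℕ → C(UnitAddCircle, ℝ), (∀ k x, 0 ≤ g k x) ∧
      (∀ k, ∫ x, |g (k + 1) x - g k x| ∂μ ≤ 2 * (1 / 2) ^ k) ∧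
      ∀ f : C(UnitAddCircle, ℂ),
        Tendsto (fun k => ∫ x, (g k x : ℂ) * f x ∂μ) atTop (𝓝 (∫ x, f x ∂ν)) := by
  set ρ : UnitAddCircle → ℝ := fun x => (ν.rnDeriv μ x).toReal with hρ
  have hρi : Integrable ρ μ := Measure.integrable_toReal_rnDeriv
  have hρ0 : ∀ x, 0 ≤ ρ x := fun x => ENNReal.toReal_nonneg
  have hci : ∀ g : C(UnitAddCircle, ℝ), Integrable g μ := fun g =>
    g.continuous.integrable_of_hasCompactSupport (HasCompactSupport.of_compactSpace _)
  have hdi : ∀ g : C(UnitAddCircle, ℝ), Integrable (fun x => |ρ x - g x|) μ := fun g =>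
    (hρi.sub (hci g)).abs
  have hex : ∀ k : ℕ, ∃ g : C(UnitAddCircle, ℝ), (∀ x, 0 ≤ g x) ∧
      ∫ x, |ρ x - g x| ∂μ ≤ (1 / 2) ^ k := fun k => by
    obtain ⟨g, hg, -⟩ := hρi.exists_boundedContinuous_integral_sub_le
      (ε := (1 / 2) ^ k) (by positivity)
    let g' : C(UnitAddCircle, ℝ) := ⟨fun x => max (g x) 0, by fun_prop⟩
    refine ⟨g', fun x => le_max_right _ _, le_trans ?_ hg⟩
    have hgi : Integrable g μ := hci g.toContinuousMap
    refine integral_mono (hdi g') (hρi.sub hgi).norm fun x => ?_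
    have h := abs_max_sub_max_le_abs (ρ x) (g x) 0
    rwa [max_eq_left (hρ0 x)] at h
  choose g hg0 hg using hex
  refine ⟨g, hg0, fun k => ?_, fun f => ?_⟩
  · have h1 : ∫ x, |g (k + 1) x - g k x| ∂μ ≤ ∫ x, (|ρ x - g (k + 1) x| + |ρ x - g k x|) ∂μ := by
      refine integral_mono ((hci (g (k + 1))).sub (hci (g k))).abs
        ((hdi _).add (hdi _)) fun x => ?_
      have h := abs_sub_le (g (k + 1) x) (ρ x) (g k x)
      rwa [abs_sub_comm (g (k + 1) x) (ρ x)] at h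
    rw [integral_add (hdi _) (hdi _)] at h1
    have h2 := hg (k + 1)
    have h3 := hg k
    have h4 : (0 : ℝ) ≤ (1 / 2) ^ k := by positivity
    rw [pow_succ] at h2
    linarith
  · have hdec : ν.HaveLebesgueDecomposition μ :=
      Measure.haveLebesgueDecomposition_of_sigmaFinite ν μ
    rw [← integral_rnDeriv_smul hac, tendsto_iff_norm_sub_tendsto_zero]
    have hlim : Tendsto (fun k : ℕ => ‖f‖ * (1 / 2 : ℝ) ^ k) atTop (𝓝 0) := by
      simpa using (tendsto_pow_atTop_nhds_zero_of_lt_one (by norm_num)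
        (by norm_num : (1 / 2 : ℝ) < 1)).const_mul ‖f‖
    refine squeeze_zero (fun _ => norm_nonneg _) (fun k => ?_) hlim
    have hgf : Integrable (fun x => (g k x : ℂ) * f x) μ :=
      (((toComplex (g k)) * f).continuous.integrable_of_hasCompactSupport
        (HasCompactSupport.of_compactSpace _))
    have hρf : Integrable (fun x => ρ x • f x) μ :=
      hρi.smul_bdd ‖f‖ f.continuous.aestronglyMeasurable
        (Eventually.of_forall f.norm_coe_le_norm)
    rw [← integral_sub hgf hρf]
    calc ‖∫ x, ((g k x : ℂ) * f x - ρ x • f x) ∂μ‖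
        ≤ ∫ x, ‖f‖ * |ρ x - g k x| ∂μ := by
          refine norm_integral_le_of_norm_le ((hdi (g k)).const_mul _)
            (Eventually.of_forall fun x => ?_)
          rw [Complex.real_smul, ← sub_mul, ← Complex.ofReal_sub, norm_mul, Complex.norm_real,
            Real.norm_eq_abs, abs_sub_comm, mul_comm]
          gcongr
          exact f.norm_coe_le_norm x
      _ ≤ ‖f‖ * (1 / 2) ^ k := by
          rw [integral_const_mul]
          gcongr
          exact hg k

/-- If each property `P k` holds eventually, then some slowly growing `κ` satisfies eventually
all `P i N` with `i ≤ κ N`. -/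
lemma exists_slow_index {P : ℕ → ℕ → Prop} (h : ∀ k, ∀ᶠ N in atTop, P k N) :
    ∃ κ : ℕ → ℕ, Monotone κ ∧ Tendsto κ atTop atTop ∧ ∀ᶠ N in atTop, ∀ i ≤ κ N, P i N := by
  classical
  let Q : ℕ → ℕ → Prop := fun N k => ∀ N' ≥ N, ∀ i ≤ k, P i N'
  have hQ : ∀ k, ∀ᶠ N in atTop, Q N k := fun k => by
    have h1 : ∀ᶠ N in atTop, ∀ i ∈ Finset.range (k + 1), P i N :=
      (Finset.eventually_all _).2 fun i _ => h i
    filter_upwards [eventually_forall_ge_atTop.2 h1] with N hN N' hN' i hi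
    exact hN N' hN' i (Finset.mem_range.2 (by lia))
  have hmono : Monotone (fun N => Nat.findGreatest (Q N) N) := fun M N hMN =>
    Nat.findGreatest_mono (fun k hk N' hN' => hk N' (hMN.trans hN')) hMN
  refine ⟨_, hmono, tendsto_atTop_atTop_of_monotone hmono fun b => ?_, ?_⟩
  · obtain ⟨N, hN, hbN⟩ := ((hQ b).and (eventually_ge_atTop b)).exists
    exact ⟨N, Nat.le_findGreatest hbN hN⟩
  · filter_upwards [hQ 0] with N hN i hi
    exact Nat.findGreatest_spec (Nat.zero_le N) hN N le_rfl i hi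

lemma exists_tendsto_of_approx {T : ℕ → ℂ} {B : ℕ → ℕ → ℂ} {b : ℕ → ℂ} {δ : ℕ → ℝ}
    (hδ : Tendsto δ atTop (𝓝 0)) (hTB : ∀ j, ∀ᶠ N in atTop, ‖T N - B j N‖ ≤ δ j)
    (hB : ∀ j, Tendsto (B j) atTop (𝓝 (b j))) :
    ∃ l, Tendsto T atTop (𝓝 l) ∧ Tendsto b atTop (𝓝 l) := by
  have hT : CauchySeq T := by
    refine Metric.cauchySeq_iff'.2 fun ε hε => ?_
    obtain ⟨j, hj⟩ := (hδ.eventually_lt_const (show 0 < ε / 4 by positivity)).exists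
    obtain ⟨N, hN⟩ := eventually_atTop.1
      ((hTB j).and (Metric.tendsto_nhds.1 (hB j) (ε / 4) (by positivity)))
    refine ⟨N, fun n hn => ?_⟩
    have h1 := hN n hn
    have h2 := hN N le_rfl
    rw [dist_comm (B j N)] at h2
    rw [← dist_eq_norm, dist_comm (T N)] at h2
    rw [← dist_eq_norm] at h1
    have h3 := dist_triangle4 (T n) (B j n) (b j) (T N)
    have h4 := dist_triangle (b j) (B j N) (T N)
    linarith [h1.1, h1.2, h2.1, h2.2]
  obtain ⟨l, hl⟩ := cauchySeq_tendsto_of_complete hT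
  refine ⟨l, hl, ?_⟩
  rw [tendsto_iff_norm_sub_tendsto_zero]
  refine squeeze_zero (fun _ => norm_nonneg _) (fun j => ?_) hδ
  rw [norm_sub_rev]
  exact le_of_tendsto (hl.sub (hB j)).norm (hTB j)

/-- Replacing `g j` by the diagonal sequence `g (κ r)` changes the averages by little. -/
lemma eventually_avg_abs_sub_le {R : Set ℕ} (hR : R.Infinite) {G : ℕ → ℕ → ℝ} {κ : ℕ → ℕ}
    (hκ : Monotone κ) (hκt : Tendsto κ atTop atTop)
    (h : ∀ᶠ N in atTop, ∀ i ≤ κ N,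
      ((initSeg R N).card : ℝ)⁻¹ * ∑ r ∈ initSeg R N, |G (i + 1) r - G i r| ≤ 4 * (1 / 2) ^ i)
    (j : ℕ) : ∀ᶠ N in atTop, ((initSeg R N).card : ℝ)⁻¹ *
      ∑ r ∈ initSeg R N, |G (κ r) r - G j r| ≤ 9 * (1 / 2) ^ j := by
  obtain ⟨r₀, hr₀⟩ := eventually_atTop.1 (hκt.eventually_ge_atTop j)
  set K := ∑ r ∈ Finset.range r₀, |G (κ r) r - G j r|
  have hK : ∀ᶠ N in atTop, K ≤ (1 / 2) ^ j * ((initSeg R N).card : ℝ) :=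
    ((tendsto_card_initSeg hR).const_mul_atTop (by positivity)).eventually_ge_atTop K
  filter_upwards [h, hK, eventually_card_initSeg_pos hR] with N hN hKN hpos
  have hpt : ∀ r ∈ initSeg R N, |G (κ r) r - G j r| ≤
      (if r ∈ Finset.range r₀ then |G (κ r) r - G j r| else 0) +
        ∑ i ∈ Finset.Ico j (κ N), |G (i + 1) r - G i r| := by
    intro r hr
    split_ifs with hrr
    · exact le_add_of_nonneg_right (Finset.sum_nonneg fun i _ => abs_nonneg _)
    · rw [zero_add]
      have hj : j ≤ κ r := hr₀ r (by simpa using hrr)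
      rw [← Finset.sum_Ico_sub (fun i => G i r) hj]
      refine (Finset.abs_sum_le_sum_abs _ _).trans
        (Finset.sum_le_sum_of_subset_of_nonneg ?_ fun _ _ _ => abs_nonneg _)
      exact Finset.Ico_subset_Ico_right (hκ (mem_initSeg.1 hr).1.2)
  have hsum := Finset.sum_le_sum hpt
  rw [Finset.sum_add_distrib, Finset.sum_comm, ← Finset.sum_filter] at hsum
  have h1 : ∑ r ∈ initSeg R N with r ∈ Finset.range r₀, |G (κ r) r - G j r| ≤ K :=
    Finset.sum_le_sum_of_subset_of_nonneg (fun r hr => (Finset.mem_filter.1 hr).2)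
      fun _ _ _ => abs_nonneg _
  have h2 : ∑ i ∈ Finset.Ico j (κ N), ∑ r ∈ initSeg R N, |G (i + 1) r - G i r| ≤
      ∑ i ∈ Finset.Ico j (κ N), ((initSeg R N).card : ℝ) * (4 * (1 / 2) ^ i) :=
    Finset.sum_le_sum fun i hi =>
      (inv_mul_le_iff₀ hpos).1 (hN i (Finset.mem_Ico.1 hi).2.le)
  have h3 : ∑ i ∈ Finset.Ico j (κ N), (1 / 2 : ℝ) ^ i ≤ (1 / 2) ^ j / (1 - 1 / 2) :=
    geom_sum_Ico_le_of_lt_one (by norm_num) (by norm_num)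
  rw [← Finset.mul_sum, ← Finset.mul_sum] at h2
  rw [inv_mul_le_iff₀ hpos]
  rw [show (1 : ℝ) - 1 / 2 = 2⁻¹ by norm_num, div_inv_eq_mul] at h3
  generalize (1 / 2 : ℝ) ^ j = x at *
  have h4 : ((initSeg R N).card : ℝ) * (4 * ∑ i ∈ Finset.Ico j (κ N), (1 / 2 : ℝ) ^ i) ≤
      (initSeg R N).card * (4 * (x * 2)) := by gcongr
  linarith

lemma norm_sum_antitone_mul_le {σ : ℕ → ℝ} (hσ : Antitone σ) (hσ0 : ∀ n, 0 ≤ σ n) {a : ℕ → ℂ}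
    {b : ℕ → ℝ} {K ε : ℝ}
    (h : ∀ n, ‖∑ i ∈ Finset.range n, a i‖ ≤ K + ε * ∑ i ∈ Finset.range n, b i) (n : ℕ) :
    ‖∑ i ∈ Finset.range n, (σ i : ℂ) * a i‖ ≤
      K * σ 0 + ε * ∑ i ∈ Finset.range n, σ i * b i := by
  have key : ∀ n, ‖∑ i ∈ Finset.range n, (σ i : ℂ) * a i - σ n * ∑ i ∈ Finset.range n, a i‖ ≤
      K * (σ 0 - σ n) +
        ε * (∑ i ∈ Finset.range n, σ i * b i - σ n * ∑ i ∈ Finset.range n, b i) := by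
    intro n
    induction n with
    | zero => simp
    | succ n ih =>
      have h1 : ∑ i ∈ Finset.range (n + 1), (σ i : ℂ) * a i -
          σ (n + 1) * ∑ i ∈ Finset.range (n + 1), a i =
          (∑ i ∈ Finset.range n, (σ i : ℂ) * a i - σ n * ∑ i ∈ Finset.range n, a i) +
            ((σ n - σ (n + 1) : ℝ) : ℂ) * ∑ i ∈ Finset.range (n + 1), a i := by
        rw [Finset.sum_range_succ, Finset.sum_range_succ]
        push_cast; ring
      have h2 : 0 ≤ σ n - σ (n + 1) := sub_nonneg.2 (hσ n.le_succ)
      have h3 : ‖((σ n - σ (n + 1) : ℝ) : ℂ) * ∑ i ∈ Finset.range (n + 1), a i‖ ≤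
          (σ n - σ (n + 1)) * (K + ε * ∑ i ∈ Finset.range (n + 1), b i) := by
        rw [norm_mul, Complex.norm_real, Real.norm_eq_abs, abs_of_nonneg h2]
        exact mul_le_mul_of_nonneg_left (h _) h2
      rw [h1]
      refine (norm_add_le_of_le ih h3).trans (le_of_eq ?_)
      rw [Finset.sum_range_succ, Finset.sum_range_succ]
      ring
  have h4 : ‖(σ n : ℂ) * ∑ i ∈ Finset.range n, a i‖ ≤
      σ n * (K + ε * ∑ i ∈ Finset.range n, b i) := by
    rw [norm_mul, Complex.norm_real, Real.norm_eq_abs, abs_of_nonneg (hσ0 n)]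
    exact mul_le_mul_of_nonneg_left (h _) (hσ0 n)
  have h5 := norm_add_le_of_le (key n) h4
  rw [sub_add_cancel] at h5
  linarith

lemma sum_initSeg {M : Type*} [AddCommMonoid M] (R : Set ℕ) (N : ℕ) (f : ℕ → M) :
    ∑ r ∈ initSeg R N, f r = ∑ r ∈ Finset.range (N + 1), (R \ {0}).indicator f r := by
  classical
  have : initSeg R N = (Finset.range (N + 1)).filter (· ∈ R \ {0}) := by
    ext r
    simp only [mem_initSeg, Finset.mem_filter, Finset.mem_range, Set.mem_sdiff,
      Set.mem_singleton_iff]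
    grind
  rw [this, Finset.sum_filter]
  simp only [Set.indicator_apply]

/-- Averages along `R` keep their limit when reweighted by a nonincreasing positive sequence. -/
lemma tendsto_antitone_weighted_avg {R : Set ℕ} {σ : ℕ → ℝ} (hσ : Antitone σ)
    (hσ0 : ∀ n, 0 ≤ σ n) (hV : Tendsto (fun N => ∑ r ∈ initSeg R N, σ r) atTop atTop)
    (hR : R.Infinite) {c : ℕ → ℂ} {l : ℂ}
    (h : Tendsto (fun N => ((initSeg R N).card : ℂ)⁻¹ * ∑ r ∈ initSeg R N, c r) atTop (𝓝 l)) :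
    Tendsto (fun N => ((∑ r ∈ initSeg R N, σ r : ℝ) : ℂ)⁻¹ *
      ∑ r ∈ initSeg R N, (σ r : ℂ) * c r) atTop (𝓝 l) := by
  rw [Metric.tendsto_nhds]
  intro ε hε
  set a : ℕ → ℂ := (R \ {0}).indicator fun r => c r - l with ha
  set b : ℕ → ℝ := (R \ {0}).indicator fun _ => 1 with hb
  have hA : ∀ N, ∑ i ∈ Finset.range (N + 1), a i =
      ∑ r ∈ initSeg R N, c r - (initSeg R N).card * l := fun N => by
    rw [ha, ← sum_initSeg, Finset.sum_sub_distrib]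
    simp
  have hB : ∀ N, ∑ i ∈ Finset.range (N + 1), b i = (initSeg R N).card := fun N => by
    rw [hb, ← sum_initSeg]
    simp
  have hb0 : ∀ i, 0 ≤ b i := Set.indicator_nonneg fun _ _ => zero_le_one
  obtain ⟨N₀, hN₀⟩ := eventually_atTop.1
    ((Metric.tendsto_nhds.1 h (ε / 2) (by positivity)).and (eventually_card_initSeg_pos hR))
  set K := ∑ n ∈ Finset.range (N₀ + 1), ‖∑ i ∈ Finset.range n, a i‖ with hK
  have hK0 : 0 ≤ K := Finset.sum_nonneg fun _ _ => norm_nonneg _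
  have hbound : ∀ n, ‖∑ i ∈ Finset.range n, a i‖ ≤ K + ε / 2 * ∑ i ∈ Finset.range n, b i := by
    intro n
    rcases lt_or_ge n (N₀ + 1) with hn | hn
    · refine (Finset.single_le_sum (f := fun n => ‖∑ i ∈ Finset.range n, a i‖)
        (fun _ _ => norm_nonneg _) (Finset.mem_range.2 hn)).trans ?_
      exact le_add_of_nonneg_right
        (mul_nonneg (by positivity) (Finset.sum_nonneg fun i _ => hb0 i))
    · obtain ⟨N, rfl⟩ : ∃ N, n = N + 1 := ⟨n - 1, by lia⟩
      obtain ⟨h1, h2⟩ := hN₀ N (by lia)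
      have h2' : ((initSeg R N).card : ℂ) ≠ 0 := by exact_mod_cast h2.ne'
      have h3 : ∑ r ∈ initSeg R N, c r - (initSeg R N).card * l =
          (initSeg R N).card *
            (((initSeg R N).card : ℂ)⁻¹ * ∑ r ∈ initSeg R N, c r - l) := by
        field_simp
      rw [hA, hB, h3, norm_mul, Complex.norm_natCast, ← dist_eq_norm]
      have := mul_le_mul_of_nonneg_left h1.le h2.le
      linarith
  have hfin := norm_sum_antitone_mul_le hσ hσ0 hbound
  filter_upwards [hV.eventually_gt_atTop 0, hV.eventually_gt_atTop (K * σ 0 / (ε / 2))]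
    with N hV0 hVN
  set V := ∑ r ∈ initSeg R N, σ r
  have h1 : ∑ i ∈ Finset.range (N + 1), (σ i : ℂ) * a i =
      ∑ r ∈ initSeg R N, (σ r : ℂ) * c r - V * l := by
    have : (fun i => (σ i : ℂ) * a i) = (R \ {0}).indicator fun r => (σ r : ℂ) * (c r - l) := by
      ext i
      by_cases hi : i ∈ R \ {0} <;> simp [ha, hi]
    simp_rw [funext_iff] at this
    simp_rw [this]
    rw [← sum_initSeg]
    simp [mul_sub, Finset.sum_sub_distrib, Finset.sum_mul, V]
  have h2 : ∑ i ∈ Finset.range (N + 1), σ i * b i = V := by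
    have : ∀ i, σ i * b i = (R \ {0}).indicator σ i := fun i => by
      by_cases hi : i ∈ R \ {0} <;> simp [hb, hi]
    simp_rw [this]
    rw [← sum_initSeg]
  have h3 := hfin (N + 1)
  rw [h1, h2] at h3
  have hV' : (V : ℂ) ≠ 0 := by exact_mod_cast hV0.ne'
  have h4 : (V : ℂ)⁻¹ * ∑ r ∈ initSeg R N, (σ r : ℂ) * c r - l =
      (V : ℂ)⁻¹ * (∑ r ∈ initSeg R N, (σ r : ℂ) * c r - V * l) := by
    field_simp
  rw [dist_eq_norm, h4, norm_mul, norm_inv, Complex.norm_real, Real.norm_eq_abs, abs_of_pos hV0,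
    inv_mul_lt_iff₀ hV0]
  rw [div_lt_iff₀ (by positivity)] at hVN
  linarith

/-- Weights on `R` with prescribed limit measure at `α`, good at every frequency, together with a
slowly decreasing scale making them at most `1`. -/
lemma exists_weight {R : Set ℕ} (hR : IsGoodSet R) (hsub : Sublacunary R) {α : ℝ}
    {μ ν : Measure UnitAddCircle} (hμ : IsLimitMeasure R α μ) [IsProbabilityMeasure ν]
    (hac : ν ≪ μ) :
    ∃ σ w : ℕ → ℝ, Antitone σ ∧ (∀ r, 0 < σ r) ∧ (∀ r, σ r ≤ 1) ∧ (∀ r, 0 ≤ w r) ∧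
      (∀ r, σ r * w r ≤ 1) ∧
      (∀ ε > 0, ∀ᶠ N : ℕ in atTop, Real.log N ≤ ε * σ N ^ 2 * (initSeg R N).card) ∧
      (∀ θ : ℝ, ∃ l, Tendsto (fun N => ((initSeg R N).card : ℂ)⁻¹ *
        ∑ r ∈ initSeg R N, (w r : ℂ) * eC (r * θ)) atTop (𝓝 l)) ∧
      ∀ k : ℤ, Tendsto (fun N => ((initSeg R N).card : ℂ)⁻¹ *
        ∑ r ∈ initSeg R N, (w r : ℂ) * eC (r * (k * α))) atTop (𝓝 (∫ x, fourier k x ∂ν)) := by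
  have hμp := hμ.isProbabilityMeasure hR.1
  obtain ⟨g, hg0, hgd, hgν⟩ := exists_continuous_approx_rnDeriv hac
  set M : ℕ → ℝ := fun k => 1 + ∑ i ∈ Finset.range (k + 1), ‖g i‖ with hM
  have hM1 : ∀ k, 1 ≤ M k := fun k =>
    le_add_of_nonneg_right (Finset.sum_nonneg fun _ _ => norm_nonneg _)
  have hM0 : ∀ k, 0 < M k := fun k => one_pos.trans_le (hM1 k)
  have hMmono : Monotone M := fun i j hij => by
    simp only [hM]
    gcongr
  have hgM : ∀ k x, g k x ≤ M k := fun k x => by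
    have h1 : ‖g k‖ ≤ ∑ i ∈ Finset.range (k + 1), ‖g i‖ :=
      Finset.single_le_sum (f := fun i => ‖g i‖) (fun _ _ => norm_nonneg _) (by simp)
    have h2 := (le_abs_self _).trans ((g k).norm_coe_le_norm x)
    simp only [hM]
    linarith
  set G : ℕ → ℕ → ℝ := fun i r => g i ((r * α : ℝ) : UnitAddCircle) with hG
  have hev : ∀ i : ℕ, ∀ᶠ N : ℕ in atTop,
      ((initSeg R N).card : ℝ)⁻¹ * ∑ r ∈ initSeg R N, |G (i + 1) r - G i r| ≤ 4 * (1 / 2) ^ i ∧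
      (i * M i ^ 2) * Real.log N ≤ (initSeg R N).card := fun i => by
    let d : C(UnitAddCircle, ℝ) := ⟨fun x => |g (i + 1) x - g i x|, by fun_prop⟩
    have hlt : ∫ x, d x ∂μ < 4 * (1 / 2) ^ i := by
      have h1 : ∫ x, d x ∂μ ≤ 2 * (1 / 2) ^ i := hgd i
      have h2 : (0 : ℝ) < (1 / 2) ^ i := by positivity
      linarith
    have h3 := Tendsto.const_mul (i * M i ^ 2 : ℝ) hsub
    rw [mul_zero] at h3
    filter_upwards [(hμ d).eventually_lt_const hlt, h3.eventually_lt_const one_pos,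
      eventually_card_initSeg_pos hR.1] with N h4 h5 h6
    refine ⟨h4.le, ?_⟩
    rw [← mul_div_assoc, div_lt_one h6] at h5
    exact h5.le
  obtain ⟨κ, hκ, hκt, hκN⟩ := exists_slow_index hev
  have happrox := eventually_avg_abs_sub_le hR.1 hκ hκt (hκN.mono fun N h i hi => (h i hi).1)
  have hdist : ∀ (θ : ℝ) (j : ℕ), ∀ᶠ N in atTop, ‖((initSeg R N).card : ℂ)⁻¹ *
      ∑ r ∈ initSeg R N, (G (κ r) r : ℂ) * eC (r * θ) - avgMap (initSeg R N)
        (fun r => ((r * α : ℝ) : UnitAddCircle)) (fun r => eC (r * θ)) (toComplex (g j))‖ ≤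
      9 * (1 / 2) ^ j := fun θ j => by
    filter_upwards [happrox j] with N hN
    refine le_trans ?_ hN
    rw [avgMap_apply, ← mul_sub, ← Finset.sum_sub_distrib, norm_mul, norm_inv,
      Complex.norm_natCast]
    gcongr
    refine norm_sum_le_of_le _ fun r _ => le_of_eq ?_
    rw [toComplex_apply, mul_comm (eC _), ← sub_mul, norm_mul, norm_eC, mul_one,
      ← Complex.ofReal_sub, Complex.norm_real, Real.norm_eq_abs]
  have hδ : Tendsto (fun j : ℕ => 9 * (1 / 2 : ℝ) ^ j) atTop (𝓝 0) := by
    simpa using (tendsto_pow_atTop_nhds_zero_of_lt_one (by norm_num)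
      (by norm_num : (1 / 2 : ℝ) < 1)).const_mul 9
  refine ⟨fun r => (M (κ r))⁻¹, fun r => G (κ r) r, fun r s hrs => ?_, fun r => ?_, fun r => ?_,
    fun r => hg0 _ _, fun r => ?_, fun ε hε => ?_, fun θ => ?_, fun k => ?_⟩
  · exact inv_anti₀ (hM0 _) (hMmono (hκ hrs))
  · exact inv_pos.2 (hM0 _)
  · exact inv_le_one_of_one_le₀ (hM1 _)
  · exact (inv_mul_le_one₀ (hM0 _)).2 (hgM _ _)
  · filter_upwards [hκN, (tendsto_natCast_atTop_atTop.comp hκt).eventually_ge_atTop ε⁻¹]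
      with N hN hN'
    have h1 := (hN (κ N) le_rfl).2
    have h2 : 0 ≤ Real.log N := Real.log_natCast_nonneg N
    have h3 : ε⁻¹ * M (κ N) ^ 2 * Real.log N ≤ (initSeg R N).card := by
      refine le_trans ?_ h1
      gcongr
      exact hN'
    have h4 : 0 < M (κ N) := hM0 _
    calc Real.log N = ε * (M (κ N))⁻¹ ^ 2 * (ε⁻¹ * M (κ N) ^ 2 * Real.log N) := by field_simp
      _ ≤ _ := by gcongr
  · choose b hb using fun j => hR.exists_tendsto_twisted α θ (toComplex (g j))
    obtain ⟨l, hl, -⟩ := exists_tendsto_of_approx hδ (hdist θ) hb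
    exact ⟨l, hl⟩
  · obtain ⟨l, hl, hl'⟩ := exists_tendsto_of_approx hδ (hdist (k * α))
      (b := fun j => ∫ x, (g j x : ℂ) * fourier k x ∂μ) (fun j => by
        refine (tendsto_avgMap_of_isLimitMeasure hμ (toComplex (g j) * fourier k)).congr
          fun N => ?_
        rw [avgMap_apply, avgMap_apply]
        congr 1
        refine Finset.sum_congr rfl fun r _ => ?_
        rw [ContinuousMap.mul_apply, fourier_coe_eq_eC, one_mul, mul_comm]
        congr 2; ring)
    rwa [tendsto_nhds_unique hl' (hgν (fourier k))] at hl

/-- The Bernoulli measure on `Bool` with success probability `p`. -/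
noncomputable def coin (p : ℝ) : Measure Bool :=
  ENNReal.ofReal p • Measure.dirac true + ENNReal.ofReal (1 - p) • Measure.dirac false

lemma isProbabilityMeasure_coin {p : ℝ} (h0 : 0 ≤ p) (h1 : p ≤ 1) :
    IsProbabilityMeasure (coin p) := by
  refine ⟨?_⟩
  simp [coin, ← ENNReal.ofReal_add h0 (sub_nonneg.2 h1)]

/-- The centered indicator of success. -/
def centered (p : ℝ) (b : Bool) : ℝ := (if b then 1 else 0) - p

lemma abs_centered_le {p : ℝ} (h0 : 0 ≤ p) (h1 : p ≤ 1) (b : Bool) : |centered p b| ≤ 1 := by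
  rw [abs_le]
  cases b <;> simp only [centered, if_true, if_false, Bool.false_eq_true] <;>
    constructor <;> linarith

lemma integral_centered {p : ℝ} (h0 : 0 ≤ p) (h1 : p ≤ 1) :
    ∫ b, centered p b ∂(coin p) = 0 := by
  rw [coin, integral_add_measure (Integrable.of_finite.smul_measure (by simp))
    (Integrable.of_finite.smul_measure (by simp)), integral_smul_measure, integral_smul_measure]
  simp [centered, ENNReal.toReal_ofReal h0, ENNReal.toReal_ofReal (sub_nonneg.2 h1)]
  ring

/-- Hoeffding's inequality for independent coin flips. -/
lemma measure_sum_centered_ge_le {p : ℕ → ℝ} (h0 : ∀ r, 0 ≤ p r) (h1 : ∀ r, p r ≤ 1)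
    [∀ r, IsProbabilityMeasure (coin (p r))] (F : Finset ℕ) {c : ℕ → ℝ} (hc : ∀ r, |c r| ≤ 1)
    {s : ℝ} (hs : 0 ≤ s) :
    (Measure.infinitePi fun r => coin (p r)).real
      {ω | s ≤ ∑ r ∈ F, centered (p r) (ω r) * c r} ≤ Real.exp (-s ^ 2 / (2 * F.card)) := by
  have hind : iIndepFun (fun r (ω : ℕ → Bool) => centered (p r) (ω r) * c r)
      (Measure.infinitePi fun r => coin (p r)) :=
    iIndepFun_infinitePi (X := fun r b => centered (p r) b * c r)
      fun r => measurable_of_countable _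
  have hsub : ∀ r ∈ F, HasSubgaussianMGF (fun ω : ℕ → Bool => centered (p r) (ω r) * c r) 1
      (Measure.infinitePi fun r => coin (p r)) := fun r _ => by
    have h := hasSubgaussianMGF_of_mem_Icc_of_integral_eq_zero
      (X := fun ω : ℕ → Bool => centered (p r) (ω r) * c r) (a := -1) (b := 1)
      (μ := Measure.infinitePi fun r => coin (p r)) ?_ ?_ ?_
    · convert h using 1
      rw [show (1 : ℝ) - -1 = 2 by norm_num]
      simp
    · exact ((measurable_of_countable fun b => centered (p r) b * c r).comp
        (measurable_pi_apply r)).aemeasurable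
    · refine Eventually.of_forall fun ω => abs_le.1 ?_
      rw [abs_mul]
      exact mul_le_one₀ (abs_centered_le (h0 r) (h1 r) _) (abs_nonneg _) (hc r)
    · rw [integral_mul_const]
      have := integral_map (μ := Measure.infinitePi fun r => coin (p r))
        (measurable_pi_apply r).aemeasurable (f := centered (p r))
        (measurable_of_countable _).aestronglyMeasurable
      rw [Measure.infinitePi_map_eval, integral_centered (h0 r) (h1 r)] at this
      rw [← this, zero_mul]
  simpa using HasSubgaussianMGF.measure_sum_ge_le_of_iIndepFun hind hsub hs

lemma ae_eventually_notMem_of_summable {Ω : Type*} [MeasurableSpace Ω] {P : Measure Ω}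
    [IsFiniteMeasure P] {B : ℕ → Set Ω} {u : ℕ → ℝ} (hu : Summable u)
    (hB : ∀ᶠ N in atTop, P.real (B N) ≤ u N) : ∀ᵐ ω ∂P, ∀ᶠ N in atTop, ω ∉ B N := by
  classical
  let B' : ℕ → Set Ω := fun N => if P.real (B N) ≤ u N then B N else ∅
  have hle : ∀ N, P (B' N) ≤ ENNReal.ofReal (u N) := fun N => by
    by_cases h : P.real (B N) ≤ u N
    · simp only [B', if_pos h]
      rw [← ofReal_measureReal]
      exact ENNReal.ofReal_le_ofReal h
    · simp [B', if_neg h]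
  have hsum : ∑' N, P (B' N) ≠ ⊤ :=
    ne_top_of_le_ne_top hu.tsum_ofReal_ne_top (ENNReal.tsum_le_tsum hle)
  filter_upwards [ae_eventually_notMem hsum] with ω hω
  filter_upwards [hω, hB] with N h1 h2
  simpa only [B', if_pos h2] using h1

lemma norm_le_two_mul_of_re_le {z : ℂ} {s : ℝ}
    (h : ∀ i < 4, (Complex.I ^ i * z).re ≤ s) : ‖z‖ ≤ 2 * s := by
  have h0 := h 0 (by norm_num)
  have h1 := h 1 (by norm_num)
  have h2 := h 2 (by norm_num)
  have h3 := h 3 (by norm_num)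
  simp [pow_succ] at h0 h1 h2 h3
  have hre : |z.re| ≤ s := abs_le.2 ⟨by linarith, h0⟩
  have him : |z.im| ≤ s := abs_le.2 ⟨by linarith, by linarith⟩
  linarith [Complex.norm_le_abs_re_add_abs_im z]

/-- An exponential polynomial with frequencies at most `N` and coefficients at most `1` is
controlled by its values on the grid of mesh `N⁻²`. -/
lemma norm_expPoly_le_of_grid {R : Set ℕ} {N : ℕ} (hN : 0 < N) {a : ℕ → ℝ} (ha : ∀ r, |a r| ≤ 1)
    {D : ℝ} (h : ∀ j < N ^ 2,
      ‖∑ r ∈ initSeg R N, (a r : ℂ) * eC (r * ((j : ℝ) / (N : ℝ) ^ 2))‖ ≤ D) (β : ℝ) :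
    ‖∑ r ∈ initSeg R N, (a r : ℂ) * eC (r * β)‖ ≤ D + 7 := by
  have hN2 : (0 : ℝ) < (N : ℝ) ^ 2 := by positivity
  have hN1 : (0 : ℝ) < N := by positivity
  set x := Int.fract β with hx
  set j := ⌊x * (N : ℝ) ^ 2⌋₊ with hj
  have hx0 : 0 ≤ x := Int.fract_nonneg β
  have hx1 : x < 1 := Int.fract_lt_one β
  have hjx : (j : ℝ) ≤ x * (N : ℝ) ^ 2 := Nat.floor_le (by positivity)
  have hxj : x * (N : ℝ) ^ 2 < j + 1 := Nat.lt_floor_add_one _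
  have hjN : j < N ^ 2 := by
    have : (j : ℝ) < ((N ^ 2 : ℕ) : ℝ) := by push_cast; nlinarith
    exact_mod_cast this
  have hper : ∀ r : ℕ, eC (r * β) = eC (r * x) := fun r => by
    have : (r : ℝ) * β = r * x + ((r * ⌊β⌋ : ℤ) : ℝ) := by
      push_cast
      rw [hx, ← mul_add, Int.fract_add_floor]
    rw [this, eC_add, eC_intCast, mul_one]
  have hdiff : |x - (j : ℝ) / (N : ℝ) ^ 2| ≤ 1 / (N : ℝ) ^ 2 := by
    have : x - (j : ℝ) / (N : ℝ) ^ 2 = (x * (N : ℝ) ^ 2 - j) / (N : ℝ) ^ 2 := by field_simp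
    rw [this, abs_div, abs_of_pos hN2, abs_of_nonneg (by linarith)]
    gcongr
    linarith
  have hcard : ((initSeg R N).card : ℝ) ≤ N := by
    have : initSeg R N ⊆ Finset.Icc 1 N := fun r hr => Finset.mem_Icc.2 (mem_initSeg.1 hr).1
    exact_mod_cast (Finset.card_le_card this).trans (by simp)
  have hd : ‖∑ r ∈ initSeg R N, (a r : ℂ) * eC (r * β) -
      ∑ r ∈ initSeg R N, (a r : ℂ) * eC (r * ((j : ℝ) / (N : ℝ) ^ 2))‖ ≤
      ∑ r ∈ initSeg R N, 7 * (1 / (N : ℝ)) := by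
    rw [← Finset.sum_sub_distrib]
    refine norm_sum_le_of_le _ fun r hr => ?_
    have hr' : (r : ℝ) ≤ N := by exact_mod_cast (mem_initSeg.1 hr).1.2
    rw [← mul_sub, norm_mul, Complex.norm_real, Real.norm_eq_abs, hper]
    calc |a r| * ‖eC (r * x) - eC (r * ((j : ℝ) / (N : ℝ) ^ 2))‖
        ≤ 1 * (7 * |r * x - r * ((j : ℝ) / (N : ℝ) ^ 2)|) := by
          gcongr
          · exact ha r
          · exact norm_eC_sub_eC_le _ _
      _ = 7 * (r * |x - (j : ℝ) / (N : ℝ) ^ 2|) := by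
          rw [← mul_sub, abs_mul, Nat.abs_cast, one_mul]
      _ ≤ 7 * (N * (1 / (N : ℝ) ^ 2)) := by gcongr
      _ = 7 * (1 / (N : ℝ)) := by field_simp
  rw [Finset.sum_const, nsmul_eq_mul] at hd
  have h7 : ((initSeg R N).card : ℝ) * (7 * (1 / (N : ℝ))) ≤ 7 := by
    calc ((initSeg R N).card : ℝ) * (7 * (1 / (N : ℝ))) ≤ N * (7 * (1 / (N : ℝ))) := by gcongr
      _ = 7 := by field_simp
  have := norm_le_norm_add_norm_sub' (∑ r ∈ initSeg R N, (a r : ℂ) * eC (r * β))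
    (∑ r ∈ initSeg R N, (a r : ℂ) * eC (r * ((j : ℝ) / (N : ℝ) ^ 2)))
  linarith [h j hjN]

/-- Random selection: a set `S ⊆ R` whose exponential sums follow the weighted ones uniformly. -/
lemma exists_subset_expSum_close {R : Set ℕ} (hR : R.Infinite) {p t : ℕ → ℝ}
    (hp0 : ∀ r, 0 ≤ p r) (hp1 : ∀ r, p r ≤ 1) (ht0 : ∀ N, 0 ≤ t N)
    (ht : ∀ ε > 0, ∀ᶠ N : ℕ in atTop, (initSeg R N).card * Real.log N ≤ ε * t N ^ 2) :
    ∃ S ⊆ R, ∀ ε > 0, ∀ᶠ N in atTop, ∀ β : ℝ,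
      ‖∑ r ∈ initSeg S N, eC (r * β) - ∑ r ∈ initSeg R N, (p r : ℂ) * eC (r * β)‖ ≤
        ε * t N := by
  classical
  have hprob : ∀ r, IsProbabilityMeasure (coin (p r)) := fun r =>
    isProbabilityMeasure_coin (hp0 r) (hp1 r)
  set P := Measure.infinitePi fun r => coin (p r) with hP
  let Z : ℕ → ℝ → (ℕ → Bool) → ℂ := fun N β ω =>
    ∑ r ∈ initSeg R N, (centered (p r) (ω r) : ℂ) * eC (r * β)
  have hlog : Tendsto (fun N : ℕ => Real.log N) atTop atTop :=
    Real.tendsto_log_atTop.comp tendsto_natCast_atTop_atTop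
  have hae : ∀ ε > 0, ∀ᵐ ω ∂P, ∀ᶠ N in atTop, ∀ β, ‖Z N β ω‖ ≤ ε * t N := by
    intro ε hε
    set s : ℕ → ℝ := fun N => ε / 3 * t N with hs
    have hs0 : ∀ N, 0 ≤ s N := fun N => mul_nonneg (by positivity) (ht0 N)
    let E : ℕ → ℕ × ℕ → Set (ℕ → Bool) := fun N ji =>
      {ω | s N ≤ (Complex.I ^ ji.2 * Z N ((ji.1 : ℝ) / (N : ℝ) ^ 2) ω).re}
    let J : ℕ → Finset (ℕ × ℕ) := fun N => Finset.range (N ^ 2) ×ˢ Finset.range 4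
    have hE : ∀ N ji, P.real (E N ji) ≤ Real.exp (-s N ^ 2 / (2 * (initSeg R N).card)) := by
      intro N ji
      let c : ℕ → ℝ := fun r => (Complex.I ^ ji.2 * eC (r * ((ji.1 : ℝ) / (N : ℝ) ^ 2))).re
      have hc : ∀ r, |c r| ≤ 1 := fun r => by
        refine (Complex.abs_re_le_norm _).trans (le_of_eq ?_)
        rw [norm_mul, norm_pow, Complex.norm_I, one_pow, norm_eC, one_mul]
      convert measure_sum_centered_ge_le hp0 hp1 (initSeg R N) hc (hs0 N) using 5 with ω
      simp only [Z, Finset.mul_sum, Complex.re_sum, c]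
      refine Finset.sum_congr rfl fun r _ => ?_
      rw [mul_left_comm, Complex.re_ofReal_mul]
    have hB : ∀ᶠ N : ℕ in atTop,
        P.real (⋃ ji ∈ J N, E N ji) ≤ 4 * (1 / (N : ℝ) ^ 2) := by
      filter_upwards [ht (ε ^ 2 / 72) (by positivity), eventually_card_initSeg_pos hR,
        eventually_gt_atTop 0] with N h1 h2 h3
      have h3' : (0 : ℝ) < N := by exact_mod_cast h3
      have h4 : Real.exp (-s N ^ 2 / (2 * (initSeg R N).card)) ≤ ((N : ℝ) ^ 4)⁻¹ := by
        rw [← Real.exp_log (show 0 < ((N : ℝ) ^ 4)⁻¹ by positivity), Real.log_inv, Real.log_pow]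
        refine Real.exp_le_exp.2 ?_
        rw [div_le_iff₀ (by positivity)]
        simp only [hs]
        push_cast
        nlinarith
      calc P.real (⋃ ji ∈ J N, E N ji) ≤ ∑ ji ∈ J N, P.real (E N ji) :=
            measureReal_biUnion_finset_le _ _
        _ ≤ ∑ ji ∈ J N, ((N : ℝ) ^ 4)⁻¹ := Finset.sum_le_sum fun ji _ => (hE N ji).trans h4
        _ = 4 * (1 / (N : ℝ) ^ 2) := by
            simp [J]
            field_simp
    have hsum : Summable fun N : ℕ => 4 * (1 / (N : ℝ) ^ 2) :=
      (Real.summable_one_div_nat_pow.2 one_lt_two).mul_left 4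
    filter_upwards [ae_eventually_notMem_of_summable hsum hB] with ω hω
    filter_upwards [hω, ht ((ε / 21) ^ 2) (by positivity),
      (tendsto_card_initSeg hR).eventually_ge_atTop 1, hlog.eventually_ge_atTop 1,
      eventually_gt_atTop 0] with N h1 h2 h3 h4 h5 β
    have h7 : 7 ≤ s N := by
      have h6 : 1 ≤ (ε / 21 * t N) ^ 2 := by
        rw [mul_pow]
        nlinarith
      have h6' := (one_le_sq_iff₀ (mul_nonneg (by positivity) (ht0 N))).1 h6
      simp only [hs]
      linarith
    have hgrid : ∀ j < N ^ 2, ‖Z N ((j : ℝ) / (N : ℝ) ^ 2) ω‖ ≤ 2 * s N := fun j hj => by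
      refine norm_le_two_mul_of_re_le fun i hi => ?_
      by_contra! hlt
      refine h1 (Set.mem_biUnion (x := (j, i)) ?_ hlt.le)
      simp [J, hj, hi]
    have := norm_expPoly_le_of_grid (R := R) h5
      (fun r => abs_centered_le (hp0 r) (hp1 r) (ω r)) hgrid β
    refine this.trans ?_
    have h8 : ε * t N = 3 * s N := by simp only [hs]; ring
    linarith
  have hall : ∀ᵐ ω ∂P, ∀ m : ℕ, ∀ᶠ N in atTop, ∀ β, ‖Z N β ω‖ ≤ 1 / ((m : ℝ) + 1) * t N :=
    ae_all_iff.2 fun m => hae _ (by positivity)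
  obtain ⟨ω, hω⟩ := hall.exists
  refine ⟨{r | r ∈ R ∧ ω r = true}, fun r hr => hr.1, fun ε hε => ?_⟩
  obtain ⟨m, hm⟩ := exists_nat_one_div_lt hε
  filter_upwards [hω m] with N hN β
  have hS : initSeg {r | r ∈ R ∧ ω r = true} N = (initSeg R N).filter (fun r => ω r = true) := by
    ext r
    simp only [mem_initSeg, Finset.mem_filter, Set.mem_ofPred_eq, and_assoc]
  have hZ : ∑ r ∈ initSeg {r | r ∈ R ∧ ω r = true} N, eC (r * β) -
      ∑ r ∈ initSeg R N, (p r : ℂ) * eC (r * β) = Z N β ω := by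
    rw [hS, Finset.sum_filter, ← Finset.sum_sub_distrib]
    refine Finset.sum_congr rfl fun r _ => ?_
    by_cases h : ω r = true <;> simp [centered, h, sub_mul]
  rw [hZ]
  refine (hN β).trans ?_
  gcongr
  exact ht0 N

lemma tendsto_charAvg_of_close {R S : Set ℕ} {p : ℕ → ℝ} {V : ℕ → ℝ}
    (hV : Tendsto V atTop atTop)
    (hclose : ∀ ε > 0, ∀ᶠ N in atTop, ∀ β : ℝ,
      ‖∑ r ∈ initSeg S N, eC (r * β) - ∑ r ∈ initSeg R N, (p r : ℂ) * eC (r * β)‖ ≤ ε * V N)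
    {β : ℝ} {l : ℂ}
    (h : Tendsto (fun N => (V N : ℂ)⁻¹ * ∑ r ∈ initSeg R N, (p r : ℂ) * eC (r * β)) atTop (𝓝 l)) :
    Tendsto (fun N => (V N : ℂ)⁻¹ * ∑ r ∈ initSeg S N, eC (r * β)) atTop (𝓝 l) := by
  have h0 : Tendsto (fun N => (V N : ℂ)⁻¹ * ∑ r ∈ initSeg S N, eC (r * β) -
      (V N : ℂ)⁻¹ * ∑ r ∈ initSeg R N, (p r : ℂ) * eC (r * β)) atTop (𝓝 0) := by
    rw [Metric.tendsto_nhds]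
    intro ε hε
    filter_upwards [hclose (ε / 2) (by positivity), hV.eventually_gt_atTop 0] with N h1 h2
    rw [dist_zero_right, ← mul_sub, norm_mul, norm_inv, Complex.norm_real, Real.norm_eq_abs,
      abs_of_pos h2, inv_mul_lt_iff₀ h2]
    have := h1 β
    nlinarith
  simpa using h0.add h

/-- If `R` is a sublacunary good set, `α` is irrational and `ν ≪ μ_{R,α}` is a
Borel probability measure, then some good subset `S ⊆ R` represents `ν` at `α`. -/
theorem representable_by_subset_of_sublacunary (R : Set ℕ) (hR : IsGoodSet R)
    (hsub : Sublacunary R) (α : ℝ) (hα : Irrational α)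
    (μ : MeasureTheory.Measure UnitAddCircle) (hμ : IsLimitMeasure R α μ)
    (ν : MeasureTheory.Measure UnitAddCircle) [MeasureTheory.IsProbabilityMeasure ν]
    (hac : ν ≪ μ) :
    ∃ S ⊆ R, IsGoodSet S ∧ IsLimitMeasure S α ν := by
  obtain ⟨σ, w, hσ, hσ0, hσ1, hw0, hσw, hlog, hconv, hconvα⟩ := exists_weight hR hsub hμ hac
  set V : ℕ → ℝ := fun N => ∑ r ∈ initSeg R N, σ r
  have htV : ∀ N, σ N * (initSeg R N).card ≤ V N := fun N => by
    rw [mul_comm, ← nsmul_eq_mul]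
    exact Finset.card_nsmul_le_sum _ _ _ fun r hr => hσ (mem_initSeg.1 hr).1.2
  have hV : Tendsto V atTop atTop := by
    refine tendsto_atTop_mono' _ ?_ (Real.tendsto_log_atTop.comp tendsto_natCast_atTop_atTop)
    filter_upwards [hlog 1 one_pos] with N hN
    refine hN.trans (le_trans ?_ (htV N))
    gcongr
    rw [one_mul]
    exact pow_le_of_le_one (hσ0 N).le (hσ1 N) two_ne_zero
  obtain ⟨S, hSR, hS⟩ := exists_subset_expSum_close hR.1 (p := fun r => σ r * w r)
    (t := fun N => σ N * (initSeg R N).card) (fun r => mul_nonneg (hσ0 r).le (hw0 r)) hσw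
    (fun N => mul_nonneg (hσ0 N).le (Nat.cast_nonneg _)) (fun ε hε => by
      filter_upwards [hlog ε hε] with N hN
      have := mul_le_mul_of_nonneg_left hN (Nat.cast_nonneg (α := ℝ) (initSeg R N).card)
      refine this.trans (le_of_eq ?_)
      ring)
  have hclose : ∀ ε > 0, ∀ᶠ N in atTop, ∀ β : ℝ, ‖∑ r ∈ initSeg S N, eC (r * β) -
      ∑ r ∈ initSeg R N, ((σ r * w r : ℝ) : ℂ) * eC (r * β)‖ ≤ ε * V N := fun ε hε => by
    filter_upwards [hS ε hε] with N hN β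
    exact (hN β).trans (mul_le_mul_of_nonneg_left (htV N) hε.le)
  have hsums : ∀ {β : ℝ} {l : ℂ}, Tendsto (fun N => ((initSeg R N).card : ℂ)⁻¹ *
      ∑ r ∈ initSeg R N, (w r : ℂ) * eC (r * β)) atTop (𝓝 l) →
      Tendsto (fun N => (V N : ℂ)⁻¹ * ∑ r ∈ initSeg S N, eC (r * β)) atTop (𝓝 l) :=
    fun {β l} h => tendsto_charAvg_of_close hV hclose (by
      refine (tendsto_antitone_weighted_avg hσ (fun n => (hσ0 n).le) hV hR.1 h).congr fun N => ?_
      congr 1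
      exact Finset.sum_congr rfl fun r _ => by push_cast; ring)
  have hcard : Tendsto (fun N => (V N : ℂ)⁻¹ * (initSeg S N).card) atTop (𝓝 1) := by
    have h := hsums (hconvα 0)
    simpa [eC_zero] using h
  have havg : ∀ {β : ℝ} {l : ℂ}, Tendsto (fun N => ((initSeg R N).card : ℂ)⁻¹ *
      ∑ r ∈ initSeg R N, (w r : ℂ) * eC (r * β)) atTop (𝓝 l) →
      Tendsto (fun N => charAvg (initSeg S N) β) atTop (𝓝 l) := fun {β l} h => by
    have h1 := (hsums h).div hcard one_ne_zero
    rw [div_one] at h1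
    refine h1.congr' ?_
    filter_upwards [hV.eventually_gt_atTop 0] with N hN
    have hN' : (V N : ℂ) ≠ 0 := by exact_mod_cast hN.ne'
    simp only [Pi.div_apply, charAvg]
    rw [mul_div_mul_left _ _ (inv_ne_zero hN'), div_eq_inv_mul]
  have hSinf : S.Infinite := by
    intro hfin
    have hb : ∀ N, ‖((initSeg S N).card : ℂ)‖ ≤ hfin.toFinset.card := fun N => by
      rw [Complex.norm_natCast]
      exact_mod_cast Finset.card_le_card fun r hr => hfin.mem_toFinset.2 (mem_initSeg.1 hr).2
    have h1 : Tendsto (fun N => ‖(V N : ℂ)⁻¹ * (initSeg S N).card‖) atTop (𝓝 0) := by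
      have h2 : Tendsto (fun N => (V N)⁻¹ * (hfin.toFinset.card : ℝ)) atTop (𝓝 0) := by
        simpa using (tendsto_inv_atTop_zero.comp hV).mul_const (hfin.toFinset.card : ℝ)
      refine squeeze_zero' (Eventually.of_forall fun _ => norm_nonneg _) ?_ h2
      filter_upwards [hV.eventually_gt_atTop 0] with N hN
      rw [norm_mul, norm_inv, Complex.norm_real, Real.norm_eq_abs, abs_of_pos hN]
      gcongr
      exact hb N
    have h3 := tendsto_nhds_unique h1 hcard.norm
    simp at h3
  have hSgood : IsGoodSet S := isGoodSet_of_charAvg hSinf fun θ => by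
    obtain ⟨l, hl⟩ := hconv θ
    exact ⟨l, havg hl⟩
  exact ⟨S, hSR, hSgood, isLimitMeasure_of_charAvg hSgood fun k => havg (hconvα k)⟩
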